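/- Let A be a real N×N matrix with 2×2 block partition A = [[A₁₁, A₁₂],[A₂₁, A₂₂]], where A₁₁ and A₂₂ are Hurwitz. Define transfer functions K₁(s) = −(sI − A₁₁)^{−1}A₁₂ and K₂(s) = (sI − A₂₂)^{−1}A₂₁. If there exists γ > 0 such that the H∞ norm of K₁ is < 1/γ and the H∞ norm of K₂ is < γ, then there exist symmetric positive definite matrices X₁, X₂ (of sizes matching the blocks) such that the block-diagonal matrix X = diag(X₁, X₂) satisfies AX + XAᵀ ≺ 0; in particular A is Hurwitz. -/

import Mathlib

open Matrix

/-- The spectral (ℓ²→ℓ²) operator norm of a complex matrix. -/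
noncomputable def specNorm {m n : Type*} [Fintype m] [Fintype n] [DecidableEq n]
    (B : Matrix m n ℂ) : ℝ :=
  ‖LinearMap.toContinuousLinearMap (Matrix.toEuclideanLin B)‖

/-- The H∞ norm of a (stable) matrix-valued transfer function `K`,
`‖K‖_{H∞} = sup_{ω ∈ ℝ} ‖K(jω)‖₂`. -/
noncomputable def hinfNorm {m n : Type*} [Fintype m] [Fintype n] [DecidableEq n]
    (K : ℝ → Matrix m n ℂ) : ℝ :=
  ⨆ ω : ℝ, specNorm (K ω)

/-- A real square matrix is Hurwitz if all of its (complex) eigenvalues have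
negative real part. -/
def IsHurwitz {m : Type*} [Fintype m] [DecidableEq m] (A : Matrix m m ℝ) : Prop :=
  ∀ μ ∈ spectrum ℂ (A.map (algebraMap ℝ ℂ)), μ.re < 0


lemma trace_mul_conjTranspose_re {m n : Type*} [Fintype m] [Fintype n] (W : Matrix m n ℂ) :
    (W * Wᴴ).trace.re = ∑ j, ∑ i, ‖W i j‖ ^ 2 := by
  rw [Finset.sum_comm]
  simp [Matrix.trace, Matrix.mul_apply, Complex.mul_conj, Complex.normSq_eq_norm_sq]
  norm_cast

lemma Matrix.IsHermitian.exists_unitary_diagonal {n : Type*} [Fintype n] [DecidableEq n]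
    {M : Matrix n n ℂ} (hM : M.IsHermitian) :
    ∃ (V : Matrix n n ℂ) (d : n → ℝ), V * Vᴴ = 1 ∧ Vᴴ * V = 1 ∧
      M = V * diagonal (fun i => (d i : ℂ)) * Vᴴ := by
  refine ⟨hM.eigenvectorUnitary, hM.eigenvalues, ?_, ?_, ?_⟩
  · exact Unitary.mul_star_self_of_mem hM.eigenvectorUnitary.2
  · exact Unitary.star_mul_self_of_mem hM.eigenvectorUnitary.2
  · conv_lhs => rw [hM.spectral_theorem, Unitary.conjStarAlgAut_apply]
    rfl

/-- A Hermitian matrix has a Hermitian generalised inverse. -/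
lemma Matrix.IsHermitian.exists_generalized_inverse {n : Type*} [Fintype n] [DecidableEq n]
    {M : Matrix n n ℂ} (hM : M.IsHermitian) :
    ∃ N : Matrix n n ℂ, N.IsHermitian ∧ M * N * M = M := by
  obtain ⟨V, d, -, hV, rfl⟩ := hM.exists_unitary_diagonal
  refine ⟨V * diagonal (fun i => (((d i)⁻¹ : ℝ) : ℂ)) * Vᴴ, ?_, ?_⟩
  · refine Matrix.isHermitian_mul_mul_conjTranspose V ?_
    refine isHermitian_diagonal_of_self_adjoint _ ?_
    ext i; simp
  · calc _ = V * diagonal (fun i => (d i : ℂ)) * (Vᴴ * V)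
          * diagonal (fun i => (((d i)⁻¹ : ℝ) : ℂ)) * (Vᴴ * V)
          * diagonal (fun i => (d i : ℂ)) * Vᴴ := by
          simp only [Matrix.mul_assoc]
      _ = _ := by
        rw [hV]
        simp only [Matrix.mul_one, Matrix.mul_assoc]
        simp only [← Matrix.mul_assoc (diagonal _) (diagonal _), diagonal_mul_diagonal]
        congr 3
        ext i
        by_cases h : d i = 0
        · simp [h]
        · have : (d i : ℂ) ≠ 0 := by exact_mod_cast h
          simp [this]

open scoped ComplexOrder in
/-- If the frequency response from `u` to `w` of `ẇ = A w + B u` has gain at most `c`, then the same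
bound holds in Frobenius norm for pairs `(W, U)` with `(A W + B U) Wᴴ` skew-Hermitian. -/
lemma sum_norm_sq_le_of_skew {n m r : Type*} [Fintype n] [Fintype m] [Fintype r]
    [DecidableEq n] [DecidableEq r]
    (A : Matrix n n ℂ) (B : Matrix n m ℂ) (W : Matrix n r ℂ) (U : Matrix m r ℂ) (c : ℝ)
    (hgain : ∀ (ω : ℝ) (w : n → ℂ) (u : m → ℂ), A *ᵥ w + B *ᵥ u = ((ω : ℂ) * Complex.I) • w →
      ∑ i, ‖w i‖ ^ 2 ≤ c ^ 2 * ∑ i, ‖u i‖ ^ 2)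
    (hskew : (A * W + B * U) * Wᴴ + W * (A * W + B * U)ᴴ = 0) :
    ∑ j, ∑ i, ‖W i j‖ ^ 2 ≤ c ^ 2 * ∑ j, ∑ i, ‖U i j‖ ^ 2 := by
  obtain ⟨N, hN, hWN⟩ := (isHermitian_mul_conjTranspose_self W).exists_generalized_inverse
  have hNW : W * Wᴴ * N * W = W := by
    have h : (W * Wᴴ * N * W - W) * (W * Wᴴ * N * W - W)ᴴ = 0 := by
      calc _ = (W * Wᴴ * N * (W * Wᴴ) - W * Wᴴ) * (W * Wᴴ * N - 1)ᴴ := by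
            simp only [conjTranspose_sub, conjTranspose_mul, Matrix.sub_mul, Matrix.mul_sub,
              conjTranspose_one, Matrix.mul_one, Matrix.mul_assoc]
        _ = 0 := by rw [hWN]; simp
    exact sub_eq_zero.mp (self_mul_conjTranspose_eq_zero.mp h)
  set F := A * W + B * U with hF
  set P := Wᴴ * N * W with hP
  have hWP : W * P = W := by rw [hP, ← Matrix.mul_assoc, ← Matrix.mul_assoc, hNW]
  have hPh : Pᴴ = P := by simp [hP, hN.eq, Matrix.mul_assoc]
  have hPP : P * P = P := by
    conv_lhs => rw [hP, Matrix.mul_assoc, hWP]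
  have hFW : F * Wᴴ = -(W * Fᴴ) := eq_neg_of_add_eq_zero_left hskew
  set T := Complex.I • (Wᴴ * N * (F * Wᴴ) * N * W) with hT
  have hTh : T.IsHermitian := by
    have h2 : (F * Wᴴ)ᴴ = -(F * Wᴴ) := by
      rw [conjTranspose_mul, conjTranspose_conjTranspose, hFW, neg_neg]
    rw [Matrix.IsHermitian, hT, conjTranspose_smul]
    simp only [conjTranspose_mul _ W, conjTranspose_mul _ N, conjTranspose_mul _ (F * Wᴴ), h2, hN.eq,
      conjTranspose_conjTranspose]
    simp [Matrix.mul_assoc]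
  have hWT : W * T = Complex.I • (F * P) := by
    have : W * (Wᴴ * N * (F * Wᴴ) * N * W) = F * P := by
      calc _ = W * Wᴴ * N * (F * Wᴴ) * N * W := by simp only [Matrix.mul_assoc]
        _ = (F * Wᴴ) * N * W := by
          congr 2
          rw [hFW, Matrix.mul_neg, ← Matrix.mul_assoc, hNW]
        _ = _ := by simp only [hP, Matrix.mul_assoc]
    rw [hT, Matrix.mul_smul, this]
  obtain ⟨V, d, hV1, hV2, hTV⟩ := hTh.exists_unitary_diagonal
  have key : A * (W * V) + B * (U * P * V) =
      W * V * diagonal (fun i => ((-d i : ℝ) : ℂ) * Complex.I) := by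
    have h1 : A * (W * V) + B * (U * P * V) = F * P * V := by
      rw [hF]
      simp only [Matrix.add_mul, Matrix.mul_assoc]
      rw [← Matrix.mul_assoc W P V, hWP]
    have h2 : F * P = -Complex.I • (W * T) := by
      rw [hWT, smul_smul]; simp
    have h3 : T * V = V * diagonal (fun i => (d i : ℂ)) := by
      rw [hTV, Matrix.mul_assoc, hV2, Matrix.mul_one]
    have h4 : diagonal (fun i => ((-d i : ℝ) : ℂ) * Complex.I)
        = -Complex.I • diagonal (fun i => (d i : ℂ)) := by
      rw [← diagonal_smul]; congr 1; ext i; simp [mul_comm]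
    rw [h1, h2, h4, Matrix.smul_mul, Matrix.mul_assoc, h3, Matrix.mul_smul, Matrix.mul_assoc]
  have hcol : ∀ j, ∑ i, ‖(W * V) i j‖ ^ 2 ≤ c ^ 2 * ∑ i, ‖(U * P * V) i j‖ ^ 2 := by
    intro j
    refine hgain (-d j) (fun i => (W * V) i j) (fun i => (U * P * V) i j) ?_
    ext i
    have := congrFun (congrFun key i) j
    rw [mul_diagonal] at this
    rw [Pi.smul_apply, smul_eq_mul, mul_comm _ ((W * V) i j), ← this]
    simp [Matrix.mul_apply, mulVec, dotProduct]
  have hsum := Finset.sum_le_sum (fun j (_ : j ∈ Finset.univ) => hcol j)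
  rw [← Finset.mul_sum, ← trace_mul_conjTranspose_re, ← trace_mul_conjTranspose_re] at hsum
  have e1 : W * V * (W * V)ᴴ = W * Wᴴ := by
    rw [conjTranspose_mul, Matrix.mul_assoc, ← Matrix.mul_assoc V, hV1, Matrix.one_mul]
  have e2 : U * P * V * (U * P * V)ᴴ = U * P * Uᴴ := by
    rw [conjTranspose_mul, Matrix.mul_assoc, ← Matrix.mul_assoc V, hV1, Matrix.one_mul,
      conjTranspose_mul, hPh, ← Matrix.mul_assoc, Matrix.mul_assoc U P P, hPP]
  have e3 : (U * (1 - P)) * (U * (1 - P))ᴴ = U * Uᴴ - U * P * Uᴴ := by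
    rw [conjTranspose_mul, conjTranspose_sub, conjTranspose_one, hPh]
    have : (1 - P) * (1 - P) = 1 - P := by
      simp [Matrix.mul_sub, Matrix.sub_mul, hPP]
    rw [Matrix.mul_assoc, ← Matrix.mul_assoc (1 - P), this]
    simp [Matrix.mul_sub, Matrix.sub_mul, Matrix.mul_assoc]
  have e4 := trace_mul_conjTranspose_re (U * (1 - P))
  rw [e3, trace_sub, Complex.sub_re] at e4
  have e5 : 0 ≤ ∑ j, ∑ i, ‖(U * (1 - P) : Matrix m r ℂ) i j‖ ^ 2 := by positivity
  rw [e1, e2] at hsum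
  rw [← trace_mul_conjTranspose_re, ← trace_mul_conjTranspose_re]
  refine hsum.trans (mul_le_mul_of_nonneg_left ?_ (sq_nonneg c))
  linarith

lemma specNorm_nonneg {m n : Type*} [Fintype m] [Fintype n] [DecidableEq n] (B : Matrix m n ℂ) :
    0 ≤ specNorm B := norm_nonneg _

lemma sum_norm_sq_mulVec_le {m n : Type*} [Fintype m] [Fintype n] [DecidableEq n]
    (B : Matrix m n ℂ) (u : n → ℂ) :
    ∑ i, ‖(B *ᵥ u) i‖ ^ 2 ≤ specNorm B ^ 2 * ∑ i, ‖u i‖ ^ 2 := by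
  have h := (LinearMap.toContinuousLinearMap (Matrix.toEuclideanLin B)).le_opNorm (WithLp.toLp 2 u)
  have h2 := pow_le_pow_left₀ (norm_nonneg _) h 2
  rw [mul_pow, EuclideanSpace.norm_sq_eq, EuclideanSpace.norm_sq_eq] at h2
  exact h2

lemma continuous_specNorm {m n : Type*} [Fintype m] [Fintype n] [DecidableEq n] :
    Continuous (specNorm : Matrix m n ℂ → ℝ) := by
  let L : Matrix m n ℂ →ₗ[ℂ] EuclideanSpace ℂ n →L[ℂ] EuclideanSpace ℂ m :=
    ((Matrix.toEuclideanLin (𝕜 := ℂ)).trans LinearMap.toContinuousLinearMap).toLinearMap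
  exact continuous_norm.comp L.continuous_of_finiteDimensional

lemma IsHurwitz.isUnit_sub {n : Type*} [Fintype n] [DecidableEq n] {A : Matrix n n ℝ}
    (hA : IsHurwitz A) {z : ℂ} (hz : 0 ≤ z.re) :
    IsUnit (z • (1 : Matrix n n ℂ) - A.map (algebraMap ℝ ℂ)) := by
  have h : z ∉ spectrum ℂ (A.map (algebraMap ℝ ℂ)) := fun hm => absurd (hA z hm) (not_lt.mpr hz)
  rwa [spectrum.notMem_iff, Algebra.algebraMap_eq_smul_one] at h

open scoped Matrix.Norms.Operator in
/-- The frequency response of a Hurwitz system is bounded. -/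
lemma IsHurwitz.bddAbove_specNorm {m n : Type*} [Fintype m] [Fintype n] [DecidableEq n]
    [DecidableEq m] {A : Matrix n n ℝ} (hA : IsHurwitz A)
    {f : Matrix n n ℂ → Matrix n m ℂ} (hf : Continuous f) :
    BddAbove (Set.range fun ω : ℝ => specNorm (f
      (((ω : ℂ) * Complex.I) • (1 : Matrix n n ℂ) - A.map (algebraMap ℝ ℂ))⁻¹)) := by
  set R : ℝ → Matrix n n ℂ := fun ω =>
    (((ω : ℂ) * Complex.I) • (1 : Matrix n n ℂ) - A.map (algebraMap ℝ ℂ))⁻¹ with hR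
  have hcont : Continuous R := by
    refine continuous_iff_continuousAt.mpr fun ω => ?_
    have hu := hA.isUnit_sub (z := (ω : ℂ) * Complex.I) (by simp)
    have h1 := NormedRing.inverse_continuousAt hu.unit
    simp only [hR, Matrix.nonsing_inv_eq_ringInverse]
    refine ContinuousAt.comp (f := fun ω : ℝ =>
      ((ω : ℂ) * Complex.I) • (1 : Matrix n n ℂ) - A.map (algebraMap ℝ ℂ)) h1 ?_
    fun_prop
  have hlim : Filter.Tendsto R (Filter.cocompact ℝ) (nhds 0) := by
    have h1 := spectrum.resolvent_tendsto_cobounded (𝕜 := ℂ) (A.map (algebraMap ℝ ℂ))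
    have h2 : Filter.Tendsto (fun ω : ℝ => (ω : ℂ) * Complex.I) (Filter.cocompact ℝ)
        (Bornology.cobounded ℂ) := by
      rw [← tendsto_norm_atTop_iff_cobounded]
      exact (tendsto_norm_cocompact_atTop (E := ℝ)).congr fun ω => by simp
    refine (h1.comp h2).congr fun ω => ?_
    simp [resolvent, hR, Matrix.nonsing_inv_eq_ringInverse, Algebra.algebraMap_eq_smul_one]
  have hc2 : Continuous fun ω => specNorm (f (R ω)) := continuous_specNorm.comp (hf.comp hcont)
  have hl2 : Filter.Tendsto (fun ω => specNorm (f (R ω))) (Filter.cocompact ℝ)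
      (nhds (specNorm (f 0))) := ((continuous_specNorm.comp hf).tendsto 0).comp hlim
  have hev := hl2.eventually (gt_mem_nhds (lt_add_one _))
  obtain ⟨K, hK, hKs⟩ := Filter.mem_cocompact.mp hev
  obtain ⟨b, hb⟩ := (hK.image hc2).bddAbove
  refine ⟨max b (specNorm (f 0) + 1), ?_⟩
  rintro _ ⟨ω, rfl⟩
  by_cases h : ω ∈ K
  · exact le_max_of_le_left (hb ⟨ω, h, rfl⟩)
  · exact le_max_of_le_right (le_of_lt (hKs h))

/-- The `H∞` norm of `± (s - A)⁻¹ B` bounds the gain at each frequency. -/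
lemma IsHurwitz.gain_le {m n : Type*} [Fintype m] [Fintype n] [DecidableEq n]
    [DecidableEq m] {A : Matrix n n ℝ} (hA : IsHurwitz A) (B : Matrix n m ℂ)
    {f : Matrix n n ℂ → Matrix n m ℂ} (hf : Continuous f)
    (hfB : ∀ M u i, ‖(f M *ᵥ u) i‖ = ‖((M * B) *ᵥ u) i‖)
    (ω : ℝ) (w : n → ℂ) (u : m → ℂ)
    (h : A.map (algebraMap ℝ ℂ) *ᵥ w + B *ᵥ u = ((ω : ℂ) * Complex.I) • w) :
    ∑ i, ‖w i‖ ^ 2 ≤ hinfNorm (fun ω => f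
      (((ω : ℂ) * Complex.I) • (1 : Matrix n n ℂ) - A.map (algebraMap ℝ ℂ))⁻¹) ^ 2
        * ∑ i, ‖u i‖ ^ 2 := by
  set S := ((ω : ℂ) * Complex.I) • (1 : Matrix n n ℂ) - A.map (algebraMap ℝ ℂ) with hS
  have hu : IsUnit S := hA.isUnit_sub (by simp)
  have hw : w = (S⁻¹ * B) *ᵥ u := by
    have h1 : B *ᵥ u = S *ᵥ w := by
      rw [hS, sub_mulVec, smul_mulVec, one_mulVec, ← h]; simp
    rw [← mulVec_mulVec, h1, mulVec_mulVec,
      Matrix.nonsing_inv_mul _ ((Matrix.isUnit_iff_isUnit_det _).mp hu), one_mulVec]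
  have h2 := sum_norm_sq_mulVec_le (f S⁻¹) u
  simp only [hfB, ← hw] at h2
  refine h2.trans (mul_le_mul_of_nonneg_right ?_ (by positivity))
  exact pow_le_pow_left₀ (specNorm_nonneg _) (le_ciSup (hA.bddAbove_specNorm hf) ω) 2

lemma isOpen_setOf_forall_dotProduct_mulVec_neg (n : Type*) [Fintype n] :
    IsOpen {M : Matrix n n ℝ | ∀ x : n → ℝ, x ≠ 0 → x ⬝ᵥ M *ᵥ x < 0} := by
  have hset : {M : Matrix n n ℝ | ∀ x : n → ℝ, x ≠ 0 → x ⬝ᵥ M *ᵥ x < 0} =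
      {M | ∀ x ∈ Metric.sphere (0 : n → ℝ) 1, x ⬝ᵥ M *ᵥ x < 0} := by
    ext M
    refine ⟨fun h x hx => h x (ne_zero_of_mem_unit_sphere (⟨x, hx⟩ : Metric.sphere (0 : n → ℝ) 1)),
      fun h x hx => ?_⟩
    have hx' : 0 < ‖x‖ := norm_pos_iff.mpr hx
    have h1 := h (‖x‖⁻¹ • x) (by simp [norm_smul, hx'.ne'])
    rw [mulVec_smul, dotProduct_smul, smul_dotProduct, smul_eq_mul, smul_eq_mul, ← mul_assoc] at h1
    exact neg_of_mul_neg_right h1 (by positivity)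
  rw [hset, isOpen_iff_mem_nhds]
  intro M hM
  refine (isCompact_sphere (0 : n → ℝ) 1).eventually_forall_of_forall_eventually fun x hx => ?_
  have hc : Continuous fun z : Matrix n n ℝ × (n → ℝ) => z.2 ⬝ᵥ z.1 *ᵥ z.2 := by fun_prop
  exact hc.continuousAt.eventually (gt_mem_nhds (hM x hx))

lemma convex_setOf_forall_dotProduct_mulVec_neg (n : Type*) [Fintype n] :
    Convex ℝ {M : Matrix n n ℝ | ∀ x : n → ℝ, x ≠ 0 → x ⬝ᵥ M *ᵥ x < 0} := by
  intro M hM N hN a b ha hb hab x hx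
  have h1 := hM x hx
  have h2 := hN x hx
  rw [add_mulVec, smul_mulVec, smul_mulVec, dotProduct_add, dotProduct_smul, dotProduct_smul,
    smul_eq_mul, smul_eq_mul]
  rcases ha.eq_or_lt with rfl | ha
  · rw [zero_add] at hab; subst hab; simpa using h2
  · nlinarith [mul_neg_of_pos_of_neg ha h1, mul_nonneg hb (neg_nonneg.mpr h2.le)]

/-- Theorem of the alternative for linear matrix inequalities. -/
lemma exists_posSemidef_of_forall_not_neg {V n : Type*} [AddCommGroup V] [Module ℝ V] [Fintype n]
    [DecidableEq n] (L : V →ₗ[ℝ] Matrix n n ℝ) (hT : ∀ p, ∃ p', L p' = (L p)ᵀ)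
    (h : ¬ ∃ p, ∀ x : n → ℝ, x ≠ 0 → x ⬝ᵥ L p *ᵥ x < 0) :
    ∃ Z : Matrix n n ℝ, Z.PosSemidef ∧ 0 < Z.trace ∧ ∀ p, (Z * L p).trace = 0 := by
  have hdisj : Disjoint {M : Matrix n n ℝ | ∀ x : n → ℝ, x ≠ 0 → x ⬝ᵥ M *ᵥ x < 0}
      (LinearMap.range L : Set (Matrix n n ℝ)) := by
    rw [Set.disjoint_left]
    rintro _ hM ⟨p, rfl⟩
    exact h ⟨p, hM⟩
  obtain ⟨f, u, hs, ht⟩ := geometric_hahn_banach_open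
    (convex_setOf_forall_dotProduct_mulVec_neg n) (isOpen_setOf_forall_dotProduct_mulVec_neg n)
    (LinearMap.range L).convex hdisj
  have hu : u ≤ 0 := by simpa using ht 0 (Submodule.zero_mem _)
  have hL : ∀ p, f (L p) = 0 := by
    intro p
    by_contra hne
    have h1 := ht (L (((u - 1) / f (L p)) • p)) ⟨_, rfl⟩
    rw [map_smul, map_smul, smul_eq_mul, div_mul_cancel₀ _ hne] at h1
    linarith
  have hpos : ∀ (v : n → ℝ) (ε : ℝ), 0 < ε → 0 < f (vecMulVec v v) + ε * f 1 := by
    intro v ε hε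
    have h1 := hs (-(vecMulVec v v + ε • 1)) (by
      intro x hx
      have h2 : 0 < x ⬝ᵥ x := by
        simpa using dotProduct_star_self_pos_iff.mpr hx
      rw [neg_mulVec, add_mulVec, smul_mulVec, one_mulVec, vecMulVec_mulVec]
      simp only [dotProduct_neg, dotProduct_add, dotProduct_smul, smul_eq_mul, op_smul_eq_smul]
      rw [dotProduct_comm x v]
      nlinarith [mul_pos hε h2, mul_self_nonneg (v ⬝ᵥ x)])
    rw [map_neg, map_add, map_smul, smul_eq_mul] at h1
    linarith
  have hone : 0 < f 1 := by
    have := hpos 0 1 one_pos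
    simpa using this
  have hvv : ∀ v : n → ℝ, 0 ≤ f (vecMulVec v v) := by
    intro v
    by_contra! hneg
    have := hpos v (-f (vecMulVec v v) / f 1) (div_pos (by linarith) hone)
    rw [div_mul_cancel₀ _ hone.ne'] at this
    linarith
  set Z : Matrix n n ℝ := of fun i j => f (single i j 1) + f (single j i 1) with hZ
  have hf : ∀ M, f M = ∑ i, ∑ j, M i j * f (single i j 1) := by
    intro M
    conv_lhs => rw [matrix_eq_sum_single M]
    simp only [map_sum]
    refine Finset.sum_congr rfl fun i _ => Finset.sum_congr rfl fun j _ => ?_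
    rw [← smul_eq_mul, ← map_smul, smul_single, smul_eq_mul, mul_one]
  have htr : ∀ M, (Z * M).trace = f M + f Mᵀ := by
    intro M
    rw [hf M, hf Mᵀ]
    simp only [Matrix.trace, Matrix.mul_apply, hZ, diag_apply, of_apply, transpose_apply, add_mul,
      Finset.sum_add_distrib]
    rw [add_comm, Finset.sum_comm]
    congr 1 <;> simp only [mul_comm]
  refine ⟨Z, PosSemidef.of_dotProduct_mulVec_nonneg ?_ ?_, ?_, ?_⟩
  · ext i j; simp [hZ, add_comm]
  · intro v
    have h1 := htr (vecMulVec v v)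
    rw [mul_vecMulVec, trace_vecMulVec, transpose_vecMulVec, dotProduct_comm] at h1
    simp only [star_trivial]
    rw [h1]
    linarith [hvv v]
  · have := htr 1
    rw [Matrix.mul_one, transpose_one] at this
    linarith
  · intro p
    obtain ⟨p', hp'⟩ := hT p
    rw [htr, ← hp', hL, hL, add_zero]

lemma tendsto_pow_zero_of_forall_spectrum {R : Type*} [NormedRing R] [NormedAlgebra ℂ R]
    [CompleteSpace R] (a : R) (h : ∀ z ∈ spectrum ℂ a, ‖z‖ < 1) :
    Filter.Tendsto (fun k : ℕ => a ^ k) Filter.atTop (nhds 0) := by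
  rcases subsingleton_or_nontrivial R with hR | hR
  · simp [Subsingleton.elim _ (0 : R)]
  have hrad : spectralRadius ℂ a < (1 : NNReal) :=
    spectrum.spectralRadius_lt_of_forall_lt a fun z hz => h z hz
  obtain ⟨r, hr1, hr2⟩ := ENNReal.lt_iff_exists_nnreal_btwn.mp hrad
  have hev := (spectrum.pow_nnnorm_pow_one_div_tendsto_nhds_spectralRadius a).eventually
    (gt_mem_nhds hr1)
  have hr : (r : ℝ) < 1 := by exact_mod_cast hr2
  refine squeeze_zero_norm' ?_ (tendsto_pow_atTop_nhds_zero_of_lt_one r.2 hr)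
  filter_upwards [hev, Filter.eventually_gt_atTop 0] with k hk hk0
  have hk' : (0 : ℝ) < k := by exact_mod_cast hk0
  have h2 := ENNReal.rpow_le_rpow hk.le hk'.le
  rw [← ENNReal.rpow_mul, one_div_mul_cancel hk'.ne', ENNReal.rpow_one, ENNReal.rpow_natCast] at h2
  exact_mod_cast h2

open scoped Matrix.Norms.Operator in
/-- Lyapunov's theorem: a symmetric solution of the Lyapunov inequality of a Hurwitz matrix is
positive definite. -/
lemma IsHurwitz.posDef_of_lyapunov {n : Type*} [Fintype n] [DecidableEq n] {A P : Matrix n n ℝ}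
    (hA : IsHurwitz A) (hP : P.IsHermitian)
    (h : ∀ x : n → ℝ, x ≠ 0 → x ⬝ᵥ (Aᵀ * P + P * A) *ᵥ x < 0) : P.PosDef := by
  have hu : IsUnit (1 - A).det := by
    have h1 := hA.isUnit_sub (z := 1) (by simp)
    have h2 : (1 : ℂ) • (1 : Matrix n n ℂ) - A.map (algebraMap ℝ ℂ)
        = (algebraMap ℝ ℂ).mapMatrix (1 - A) := by
      rw [map_sub, map_one, one_smul, RingHom.mapMatrix_apply]
    rw [h2, Matrix.isUnit_iff_isUnit_det, ← RingHom.map_det, isUnit_iff_ne_zero] at h1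
    exact isUnit_iff_ne_zero.mpr fun h0 => h1 (by rw [h0, map_zero])
  set C := (1 + A) * (1 - A)⁻¹ with hC
  have hstep : ∀ x : n → ℝ, x ≠ 0 → (C *ᵥ x) ⬝ᵥ P *ᵥ (C *ᵥ x) < x ⬝ᵥ P *ᵥ x := by
    intro x hx
    set y := (1 - A)⁻¹ *ᵥ x with hy
    have hxy : x = y - A *ᵥ y := by
      have h0 : (1 - A) *ᵥ y = x := by
        rw [hy, mulVec_mulVec, Matrix.mul_nonsing_inv _ hu, one_mulVec]
      rw [sub_mulVec, one_mulVec] at h0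
      exact h0.symm
    have hCx : C *ᵥ x = y + A *ᵥ y := by
      rw [hC, ← mulVec_mulVec, ← hy, add_mulVec, one_mulVec]
    have hy0 : y ≠ 0 := by
      intro h0
      rw [h0] at hxy
      simp [hxy] at hx
    have h1 := h y hy0
    rw [add_mulVec, dotProduct_add, ← mulVec_mulVec, ← mulVec_mulVec, dotProduct_mulVec y Aᵀ,
      vecMul_transpose] at h1
    rw [hCx]
    conv_rhs => rw [hxy]
    simp only [mulVec_add, mulVec_sub, dotProduct_add, dotProduct_sub, add_dotProduct,
      sub_dotProduct]
    linarith
  have hpow : Filter.Tendsto (fun k : ℕ => (C.map (algebraMap ℝ ℂ)) ^ k) Filter.atTop (nhds 0) := by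
    refine tendsto_pow_zero_of_forall_spectrum _ fun z hz => ?_
    rw [← Matrix.spectrum_toLin', ← Module.End.hasEigenvalue_iff_mem_spectrum] at hz
    obtain ⟨v, hv⟩ := hz.exists_hasEigenvector
    have hv1 : C.map (algebraMap ℝ ℂ) *ᵥ v = z • v := hv.apply_eq_smul
    by_contra! hz1
    set y := ((1 - A)⁻¹.map (algebraMap ℝ ℂ)) *ᵥ v with hy
    have hvy : y - A.map (algebraMap ℝ ℂ) *ᵥ y = v := by
      have h1 : (1 - A.map (algebraMap ℝ ℂ)) * (1 - A)⁻¹.map (algebraMap ℝ ℂ) = 1 := by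
        have := congrArg (algebraMap ℝ ℂ).mapMatrix (Matrix.mul_nonsing_inv _ hu)
        simpa only [map_mul, map_sub, map_one, RingHom.mapMatrix_apply] using this
      have h2 : (1 - A.map (algebraMap ℝ ℂ)) *ᵥ y = v := by
        rw [hy, mulVec_mulVec, h1, one_mulVec]
      rwa [sub_mulVec, one_mulVec] at h2
    have hCy : y + A.map (algebraMap ℝ ℂ) *ᵥ y = z • v := by
      have h1 : C.map (algebraMap ℝ ℂ)
          = (1 + A.map (algebraMap ℝ ℂ)) * (1 - A)⁻¹.map (algebraMap ℝ ℂ) := by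
        have := congrArg (algebraMap ℝ ℂ).mapMatrix hC
        simpa only [map_mul, map_add, map_one, RingHom.mapMatrix_apply] using this
      rw [← hv1, h1, ← mulVec_mulVec, ← hy, add_mulVec, one_mulVec]
    have hy0 : y ≠ 0 := fun h0 => hv.2 (by rw [← hvy, h0]; simp)
    have hrel : (z + 1) • (A.map (algebraMap ℝ ℂ) *ᵥ y) = (z - 1) • y := by
      rw [← hvy, smul_sub] at hCy
      rw [add_smul, sub_smul, one_smul, one_smul]
      linear_combination hCy
    have hz0 : z + 1 ≠ 0 := by
      intro h0
      rw [h0, zero_smul, eq_neg_of_add_eq_zero_left h0] at hrel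
      have h3 : (-1 - 1 : ℂ) ≠ 0 := by norm_num
      exact hy0 ((smul_eq_zero.mp hrel.symm).resolve_left h3)
    have hre : 0 ≤ ((z - 1) / (z + 1)).re := by
      have h1 : 1 ≤ z.re * z.re + z.im * z.im := by
        rw [← Complex.normSq_apply, Complex.normSq_eq_norm_sq]
        nlinarith
      rw [Complex.div_re, ← add_div]
      refine div_nonneg ?_ (Complex.normSq_nonneg _)
      simp only [Complex.sub_re, Complex.add_re, Complex.one_re, Complex.sub_im, Complex.add_im,
        Complex.one_im]
      nlinarith
    have hinj := Matrix.mulVec_injective_of_isUnit (hA.isUnit_sub hre)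
    refine hy0 (hinj ?_)
    rw [mulVec_zero, sub_mulVec, smul_mulVec, one_mulVec, div_eq_inv_mul, mul_smul, ← hrel,
      inv_smul_smul₀ hz0, sub_self]
  have hpow' : Filter.Tendsto (fun k : ℕ => C ^ k) Filter.atTop (nhds 0) := by
    have hc : Continuous fun M : Matrix n n ℂ => M.map Complex.re :=
      continuous_id.matrix_map Complex.continuous_re
    have h1 := (hc.tendsto 0).comp hpow
    have h2 : (0 : Matrix n n ℂ).map Complex.re = 0 := by ext; simp
    rw [h2] at h1
    refine h1.congr fun k => ?_
    have h3 : C.map (algebraMap ℝ ℂ) ^ k = (C ^ k).map (algebraMap ℝ ℂ) :=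
      (map_pow (algebraMap ℝ ℂ).mapMatrix C k).symm
    ext i j
    simp only [Function.comp_apply, h3]
    simp
  have hle : ∀ x : n → ℝ, (C *ᵥ x) ⬝ᵥ P *ᵥ (C *ᵥ x) ≤ x ⬝ᵥ P *ᵥ x := by
    intro x
    by_cases hx : x = 0
    · simp [hx]
    · exact (hstep x hx).le
  have hnonneg : ∀ x : n → ℝ, 0 ≤ x ⬝ᵥ P *ᵥ x := by
    intro x
    have hanti : Antitone fun k : ℕ => (C ^ k *ᵥ x) ⬝ᵥ P *ᵥ (C ^ k *ᵥ x) := by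
      refine antitone_nat_of_succ_le fun k => ?_
      have := hle (C ^ k *ᵥ x)
      rwa [mulVec_mulVec, ← pow_succ'] at this
    have hc : Continuous fun M : Matrix n n ℝ => (M *ᵥ x) ⬝ᵥ P *ᵥ (M *ᵥ x) := by fun_prop
    have hlim := (hc.tendsto 0).comp hpow'
    have := hanti.le_of_tendsto hlim 0
    simpa using this
  refine PosDef.of_dotProduct_mulVec_pos hP fun x hx => ?_
  rw [star_trivial]
  exact (hnonneg (C *ᵥ x)).trans_lt (hstep x hx)

lemma sum_norm_sq_map_algebraMap {m n : Type*} [Fintype m] [Fintype n] (M : Matrix m n ℝ) :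
    ∑ j, ∑ i, ‖M.map (algebraMap ℝ ℂ) i j‖ ^ 2 = (M * Mᵀ).trace := by
  rw [Finset.sum_comm]
  simp [Matrix.trace, Matrix.mul_apply, sq]

lemma conjTranspose_map_algebraMap {m n : Type*} (M : Matrix m n ℝ) :
    (M.map (algebraMap ℝ ℂ))ᴴ = Mᵀ.map (algebraMap ℝ ℂ) := by
  ext i j
  simp

lemma trace_mul_transpose_le_of_skew {n m r : Type*} [Fintype n] [Fintype m] [Fintype r]
    [DecidableEq n] [DecidableEq m] [DecidableEq r] {A : Matrix n n ℝ} (hA : IsHurwitz A)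
    (B : Matrix n m ℝ) (W : Matrix n r ℝ) (U : Matrix m r ℝ)
    {f : Matrix n n ℂ → Matrix n m ℂ} (hf : Continuous f)
    (hfB : ∀ M u i, ‖(f M *ᵥ u) i‖ = ‖((M * B.map (algebraMap ℝ ℂ)) *ᵥ u) i‖)
    (hskew : (A * W + B * U) * Wᵀ + W * (A * W + B * U)ᵀ = 0) :
    (W * Wᵀ).trace ≤ hinfNorm (fun ω => f
      (((ω : ℂ) * Complex.I) • (1 : Matrix n n ℂ) - A.map (algebraMap ℝ ℂ))⁻¹) ^ 2
        * (U * Uᵀ).trace := by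
  have hmap : (A.map (algebraMap ℝ ℂ) * W.map (algebraMap ℝ ℂ)
      + B.map (algebraMap ℝ ℂ) * U.map (algebraMap ℝ ℂ)) = (A * W + B * U).map (algebraMap ℝ ℂ) := by
    rw [Matrix.map_add _ (map_add _), Matrix.map_mul, Matrix.map_mul]
  have h := sum_norm_sq_le_of_skew (A.map (algebraMap ℝ ℂ)) (B.map (algebraMap ℝ ℂ))
    (W.map (algebraMap ℝ ℂ)) (U.map (algebraMap ℝ ℂ)) _ (hA.gain_le _ hf hfB) (by
      rw [hmap, conjTranspose_map_algebraMap, conjTranspose_map_algebraMap,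
        ← Matrix.map_mul, ← Matrix.map_mul, ← Matrix.map_add _ (map_add _), hskew]
      exact Matrix.map_zero _ (map_zero _))
  rwa [sum_norm_sq_map_algebraMap, sum_norm_sq_map_algebraMap] at h

/-- The Lyapunov operator restricted to block-diagonal matrices. -/
def blockLyapunov {m n : Type*} [Fintype m] [Fintype n] (A : Matrix (m ⊕ n) (m ⊕ n) ℝ) :
    Matrix m m ℝ × Matrix n n ℝ →ₗ[ℝ] Matrix (m ⊕ n) (m ⊕ n) ℝ where
  toFun P := Aᵀ * fromBlocks P.1 0 0 P.2 + fromBlocks P.1 0 0 P.2 * A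
  map_add' P Q := by
    have h : fromBlocks (P + Q).1 0 0 (P + Q).2
        = fromBlocks P.1 0 0 P.2 + fromBlocks Q.1 0 0 Q.2 := by simp [fromBlocks_add]
    rw [h, Matrix.mul_add, Matrix.add_mul]
    abel
  map_smul' c P := by
    have h : fromBlocks (c • P).1 0 0 (c • P).2 = c • fromBlocks P.1 0 0 P.2 := by
      simp [fromBlocks_smul]
    rw [h]
    simp

lemma blockLyapunov_apply {m n : Type*} [Fintype m] [Fintype n] (A : Matrix (m ⊕ n) (m ⊕ n) ℝ)
    (P : Matrix m m ℝ × Matrix n n ℝ) :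
    blockLyapunov A P = Aᵀ * fromBlocks P.1 0 0 P.2 + fromBlocks P.1 0 0 P.2 * A := rfl

lemma blockLyapunov_transpose {m n : Type*} [Fintype m] [Fintype n]
    (A : Matrix (m ⊕ n) (m ⊕ n) ℝ) (P : Matrix m m ℝ × Matrix n n ℝ) :
    blockLyapunov A (P.1ᵀ, P.2ᵀ) = (blockLyapunov A P)ᵀ := by
  simp only [blockLyapunov_apply, transpose_add, transpose_mul, transpose_transpose,
    fromBlocks_transpose, transpose_zero]
  rw [add_comm]

lemma trace_fromBlocks_eq_add {m n : Type*} [Fintype m] [Fintype n] (A : Matrix m m ℝ)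
    (B : Matrix m n ℝ) (C : Matrix n m ℝ) (D : Matrix n n ℝ) :
    (fromBlocks A B C D).trace = A.trace + D.trace := by
  simp [Matrix.trace]

lemma trace_mul_blockLyapunov {m n r : Type*} [Fintype m] [Fintype n] [Fintype r]
    (A₁₁ : Matrix m m ℝ) (A₁₂ : Matrix m n ℝ) (A₂₁ : Matrix n m ℝ) (A₂₂ : Matrix n n ℝ)
    (W : Matrix m r ℝ) (U : Matrix n r ℝ) (P : Matrix m m ℝ × Matrix n n ℝ) :
    (fromRows W U * (fromRows W U)ᵀ * blockLyapunov (fromBlocks A₁₁ A₁₂ A₂₁ A₂₂) P).trace =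
      (P.1 * ((A₁₁ * W + A₁₂ * U) * Wᵀ + W * (A₁₁ * W + A₁₂ * U)ᵀ)).trace +
      (P.2 * ((A₂₂ * U + A₂₁ * W) * Uᵀ + U * (A₂₂ * U + A₂₁ * W)ᵀ)).trace := by
  set A := fromBlocks A₁₁ A₁₂ A₂₁ A₂₂ with hA
  set N := fromRows W U with hN
  set D := fromBlocks P.1 0 0 P.2 with hD
  have h1 : (N * Nᵀ * blockLyapunov A P).trace = (D * (A * N * Nᵀ + N * (A * N)ᵀ)).trace := by
    rw [blockLyapunov_apply, Matrix.mul_add, trace_add, Matrix.mul_add, trace_add, add_comm, ← hD]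
    congr 1
    · rw [← Matrix.mul_assoc, trace_mul_comm, ← Matrix.mul_assoc, trace_mul_comm, Matrix.mul_assoc A]
    · rw [← Matrix.mul_assoc, trace_mul_comm, transpose_mul, Matrix.mul_assoc N]
  have h2 : A * N = fromRows (A₁₁ * W + A₁₂ * U) (A₂₂ * U + A₂₁ * W) := by
    rw [hA, hN, fromBlocks_mul_fromRows, add_comm (A₂₂ * U)]
  rw [h1, h2, hN, hD, transpose_fromRows, transpose_fromRows, fromRows_mul_fromCols,
    fromRows_mul_fromCols, fromBlocks_add, fromBlocks_multiply, trace_fromBlocks_eq_add]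
  simp

lemma eq_zero_of_forall_trace_mul_eq_zero {n : Type*} [Fintype n] (M : Matrix n n ℝ)
    (h : ∀ P : Matrix n n ℝ, (P * M).trace = 0) : M = 0 := by
  have := h Mᴴ
  rwa [trace_conjTranspose_mul_self_eq_zero_iff] at this

lemma isHurwitz_of_lyapunov {n : Type*} [Fintype n] [DecidableEq n] {A P : Matrix n n ℝ}
    (hP : P.PosDef) (h : ∀ x : n → ℝ, x ≠ 0 → x ⬝ᵥ (Aᵀ * P + P * A) *ᵥ x < 0) :
    IsHurwitz A := by
  intro z hz
  rw [← Matrix.spectrum_toLin', ← Module.End.hasEigenvalue_iff_mem_spectrum] at hz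
  obtain ⟨v, hv⟩ := hz.exists_hasEigenvector
  have hv1 : A.map (algebraMap ℝ ℂ) *ᵥ v = z • v := hv.apply_eq_smul
  set x : n → ℝ := fun i => (v i).re with hx
  set y : n → ℝ := fun i => (v i).im with hy
  have hAx : A *ᵥ x = z.re • x - z.im • y := by
    ext i
    have := congrArg Complex.re (congrFun hv1 i)
    simpa [mulVec, dotProduct, hx, hy] using this
  have hAy : A *ᵥ y = z.re • y + z.im • x := by
    ext i
    have := congrArg Complex.im (congrFun hv1 i)
    simpa [mulVec, dotProduct, hx, hy] using this
  have hform : ∀ x : n → ℝ, x ⬝ᵥ (Aᵀ * P + P * A) *ᵥ x = 2 * (x ⬝ᵥ P *ᵥ (A *ᵥ x)) := by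
    intro x
    have hPt : Pᵀ = P := hP.1
    rw [add_mulVec, dotProduct_add, ← mulVec_mulVec, ← mulVec_mulVec, dotProduct_mulVec x Aᵀ,
      vecMul_transpose, dotProduct_mulVec (A *ᵥ x), ← mulVec_transpose, hPt,
      dotProduct_comm (P *ᵥ _)]
    ring
  have hsymm : x ⬝ᵥ P *ᵥ y = y ⬝ᵥ P *ᵥ x := by
    have hPt : Pᵀ = P := hP.1
    rw [dotProduct_mulVec, ← mulVec_transpose, hPt, dotProduct_comm]
  have hle : ∀ x : n → ℝ, x ⬝ᵥ (Aᵀ * P + P * A) *ᵥ x ≤ 0 := fun x => by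
    by_cases hx : x = 0
    · simp [hx]
    · exact (h x hx).le
  have hnn : ∀ x : n → ℝ, 0 ≤ x ⬝ᵥ P *ᵥ x := fun x => by
    simpa using hP.posSemidef.dotProduct_mulVec_nonneg x
  have hlt : x ⬝ᵥ (Aᵀ * P + P * A) *ᵥ x + y ⬝ᵥ (Aᵀ * P + P * A) *ᵥ y < 0 := by
    by_cases hx0 : x = 0
    · have hy0 : y ≠ 0 := by
        intro hy0
        refine hv.2 (funext fun i => Complex.ext ?_ ?_)
        · exact congrFun hx0 i
        · exact congrFun hy0 i
      exact add_neg_of_nonpos_of_neg (hle x) (h y hy0)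
    · exact add_neg_of_neg_of_nonpos (h x hx0) (hle y)
  rw [hform, hform, hAx, hAy] at hlt
  simp only [mulVec_add, mulVec_sub, mulVec_smul, dotProduct_add, dotProduct_sub, dotProduct_smul,
    smul_eq_mul, hsymm] at hlt
  by_contra! hz0
  nlinarith [mul_nonneg hz0 (hnn x), mul_nonneg hz0 (hnn y)]

theorem small_gain_block_diagonal_stability {k₁ k₂ : ℕ}
    (A₁₁ : Matrix (Fin k₁) (Fin k₁) ℝ) (A₁₂ : Matrix (Fin k₁) (Fin k₂) ℝ)
    (A₂₁ : Matrix (Fin k₂) (Fin k₁) ℝ) (A₂₂ : Matrix (Fin k₂) (Fin k₂) ℝ)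
    (h₁₁ : IsHurwitz A₁₁) (h₂₂ : IsHurwitz A₂₂) (γ : ℝ) (hγ : 0 < γ)
    (hK₁ : hinfNorm (fun ω =>
      -((((ω : ℂ) * Complex.I) • (1 : Matrix (Fin k₁) (Fin k₁) ℂ)
          - A₁₁.map (algebraMap ℝ ℂ))⁻¹ * A₁₂.map (algebraMap ℝ ℂ))) < 1 / γ)
    (hK₂ : hinfNorm (fun ω =>
      ((((ω : ℂ) * Complex.I) • (1 : Matrix (Fin k₂) (Fin k₂) ℂ)
          - A₂₂.map (algebraMap ℝ ℂ))⁻¹ * A₂₁.map (algebraMap ℝ ℂ))) < γ) :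
    (∃ X₁ : Matrix (Fin k₁) (Fin k₁) ℝ, ∃ X₂ : Matrix (Fin k₂) (Fin k₂) ℝ,
      X₁.PosDef ∧ X₂.PosDef ∧
      (-(Matrix.fromBlocks A₁₁ A₁₂ A₂₁ A₂₂ * Matrix.fromBlocks X₁ 0 0 X₂
        + Matrix.fromBlocks X₁ 0 0 X₂ * (Matrix.fromBlocks A₁₁ A₁₂ A₂₁ A₂₂)ᵀ)).PosDef)
    ∧ IsHurwitz (Matrix.fromBlocks A₁₁ A₁₂ A₂₁ A₂₂) := by
  set A := fromBlocks A₁₁ A₁₂ A₂₁ A₂₂ with hA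
  set R := algebraMap ℝ ℂ
  have hfeas : ∃ P, ∀ x : Fin k₁ ⊕ Fin k₂ → ℝ, x ≠ 0 → x ⬝ᵥ blockLyapunov A P *ᵥ x < 0 := by
    by_contra hno
    obtain ⟨Z, hZ, hZtr, hZL⟩ := exists_posSemidef_of_forall_not_neg (blockLyapunov A)
      (fun P => ⟨_, blockLyapunov_transpose A P⟩) hno
    obtain ⟨r, v, hv⟩ := posSemidef_iff_eq_sum_vecMulVec.mp hZ
    set W : Matrix (Fin k₁) (Fin r) ℝ := of fun i k => v k (Sum.inl i) with hW
    set U : Matrix (Fin k₂) (Fin r) ℝ := of fun i k => v k (Sum.inr i) with hU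
    have hZN : Z = fromRows W U * (fromRows W U)ᵀ := by
      rw [hv]
      ext i j
      rcases i with i | i <;> rcases j with j | j <;>
        simp [Matrix.sum_apply, vecMulVec_apply, Matrix.mul_apply, hW, hU]
    have hskew₁ := eq_zero_of_forall_trace_mul_eq_zero
      ((A₁₁ * W + A₁₂ * U) * Wᵀ + W * (A₁₁ * W + A₁₂ * U)ᵀ) fun P => by
        have := hZL (P, 0)
        rw [hZN, hA, trace_mul_blockLyapunov] at this
        simpa using this
    have hskew₂ := eq_zero_of_forall_trace_mul_eq_zero
      ((A₂₂ * U + A₂₁ * W) * Uᵀ + U * (A₂₂ * U + A₂₁ * W)ᵀ) fun P => by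
        have := hZL (0, P)
        rw [hZN, hA, trace_mul_blockLyapunov] at this
        simpa using this
    have h1 := trace_mul_transpose_le_of_skew h₁₁ A₁₂ W U
      (f := fun M => -(M * A₁₂.map R)) (by fun_prop) (fun M u i => by simp [neg_mulVec, R]) hskew₁
    have h2 := trace_mul_transpose_le_of_skew h₂₂ A₂₁ U W
      (f := fun M => M * A₂₁.map R) (by fun_prop) (fun M u i => rfl) hskew₂
    have htr : 0 < (W * Wᵀ).trace + (U * Uᵀ).trace := by
      rwa [hZN, transpose_fromRows, fromRows_mul_fromCols, trace_fromBlocks_eq_add] at hZtr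
    have hWnn : 0 ≤ (W * Wᵀ).trace := (posSemidef_self_mul_conjTranspose W).trace_nonneg
    have hUnn : 0 ≤ (U * Uᵀ).trace := (posSemidef_self_mul_conjTranspose U).trace_nonneg
    have hlt₁ := pow_lt_pow_left₀ hK₁ (Real.iSup_nonneg fun _ => specNorm_nonneg _) two_ne_zero
    have hlt₂ := pow_lt_pow_left₀ hK₂ (Real.iSup_nonneg fun _ => specNorm_nonneg _) two_ne_zero
    have h1' := h1.trans (mul_le_mul_of_nonneg_right hlt₁.le hUnn)
    have h2' := h2.trans (mul_le_mul_of_nonneg_right hlt₂.le hWnn)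
    have hg : γ ^ 2 * (1 / γ) ^ 2 = 1 := by field_simp
    have hγ2 : 0 < γ ^ 2 := by positivity
    rcases hUnn.eq_or_lt with hU0 | hU0
    · rw [← hU0, mul_zero] at h1'
      linarith
    · have h3 := h1.trans_lt (mul_lt_mul_of_pos_right hlt₁ hU0)
      have h4 := mul_lt_mul_of_pos_left h3 hγ2
      rw [← mul_assoc, hg, one_mul] at h4
      linarith
  obtain ⟨⟨Q₁, Q₂⟩, hQ⟩ := hfeas
  set P₁ := Q₁ + Q₁ᵀ with hP₁
  set P₂ := Q₂ + Q₂ᵀ with hP₂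
  have hP : ∀ x : Fin k₁ ⊕ Fin k₂ → ℝ, x ≠ 0 → x ⬝ᵥ blockLyapunov A (P₁, P₂) *ᵥ x < 0 := by
    intro x hx
    have h1 : (P₁, P₂) = (Q₁, Q₂) + (Q₁ᵀ, Q₂ᵀ) := rfl
    have h2 := blockLyapunov_transpose A (Q₁, Q₂)
    rw [h1, map_add, h2, add_mulVec, dotProduct_add, mulVec_transpose, dotProduct_comm x (_ ᵥ* _),
      ← dotProduct_mulVec]
    linarith [hQ x hx]
  have hP₁h : P₁.IsHermitian := by
    rw [Matrix.IsHermitian, conjTranspose_eq_transpose_of_trivial, hP₁, transpose_add,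
      transpose_transpose, add_comm]
  have hP₂h : P₂.IsHermitian := by
    rw [Matrix.IsHermitian, conjTranspose_eq_transpose_of_trivial, hP₂, transpose_add,
      transpose_transpose, add_comm]
  have hblocks : blockLyapunov A (P₁, P₂) = fromBlocks (A₁₁ᵀ * P₁ + P₁ * A₁₁)
      (A₂₁ᵀ * P₂ + P₁ * A₁₂) (A₁₂ᵀ * P₁ + P₂ * A₂₁) (A₂₂ᵀ * P₂ + P₂ * A₂₂) := by
    simp [blockLyapunov_apply, hA, fromBlocks_transpose, fromBlocks_multiply, fromBlocks_add]
  have hpos₁ : P₁.PosDef := h₁₁.posDef_of_lyapunov hP₁h fun x hx => by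
    have := hP (Sum.elim x 0) fun h0 => hx (funext fun i => congrFun h0 (Sum.inl i))
    simpa [hblocks, fromBlocks_mulVec, sumElim_dotProduct_sumElim] using this
  have hpos₂ : P₂.PosDef := h₂₂.posDef_of_lyapunov hP₂h fun x hx => by
    have := hP (Sum.elim 0 x) fun h0 => hx (funext fun i => congrFun h0 (Sum.inr i))
    simpa [hblocks, fromBlocks_mulVec, sumElim_dotProduct_sumElim] using this
  have hposD : (fromBlocks P₁ 0 0 P₂).PosDef := by
    refine PosDef.of_dotProduct_mulVec_pos ?_ fun x hx => ?_
    · exact hP₁h.fromBlocks (by simp) hP₂h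
    · obtain ⟨a, b, rfl⟩ : ∃ a b, x = Sum.elim a b := ⟨_, _, (Sum.elim_comp_inl_inr x).symm⟩
      simp only [star_trivial, fromBlocks_mulVec, sumElim_dotProduct_sumElim, Sum.elim_comp_inl,
        Sum.elim_comp_inr, zero_mulVec, add_zero, zero_add]
      have ha := hpos₁.posSemidef.dotProduct_mulVec_nonneg a
      have hb := hpos₂.posSemidef.dotProduct_mulVec_nonneg b
      rw [star_trivial] at ha hb
      by_cases ha0 : a = 0
      · have hb0 : b ≠ 0 := by
          rintro rfl
          exact hx (by rw [ha0, Sum.elim_zero_zero])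
        have := hpos₂.dotProduct_mulVec_pos hb0
        rw [star_trivial] at this
        linarith
      · have := hpos₁.dotProduct_mulVec_pos ha0
        rw [star_trivial] at this
        linarith
  refine ⟨⟨P₁⁻¹, P₂⁻¹, hpos₁.inv, hpos₂.inv, ?_⟩, isHurwitz_of_lyapunov hposD hP⟩
  set D := fromBlocks P₁ 0 0 P₂ with hD
  set X := fromBlocks P₁⁻¹ 0 0 P₂⁻¹ with hX
  have hu₁ : IsUnit P₁.det := (Matrix.isUnit_iff_isUnit_det _).mp hpos₁.isUnit
  have hu₂ : IsUnit P₂.det := (Matrix.isUnit_iff_isUnit_det _).mp hpos₂.isUnit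
  have hDX : D * X = 1 := by
    simp [hD, hX, fromBlocks_multiply, Matrix.mul_nonsing_inv _ hu₁, Matrix.mul_nonsing_inv _ hu₂]
  have hXD : X * D = 1 := mul_eq_one_comm.mp hDX
  have hXh : Xᴴ = X := IsHermitian.fromBlocks hpos₁.inv.1 (by simp) hpos₂.inv.1
  have hneg : (-(blockLyapunov A (P₁, P₂))).PosDef := by
    refine PosDef.of_dotProduct_mulVec_pos ?_ fun x hx => ?_
    · have h := blockLyapunov_transpose A (P₁, P₂)
      have hT₁ : P₁ᵀ = P₁ := hP₁h
      have hT₂ : P₂ᵀ = P₂ := hP₂h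
      simp only [hT₁, hT₂] at h
      rw [Matrix.IsHermitian, conjTranspose_eq_transpose_of_trivial, transpose_neg, ← h]
    · rw [star_trivial, neg_mulVec, dotProduct_neg]
      linarith [hP x hx]
  have hinj : Function.Injective X.mulVec := fun x y hxy => by
    have := congrArg D.mulVec hxy
    simpa only [mulVec_mulVec, hDX, one_mulVec] using this
  have hfin := hneg.conjTranspose_mul_mul_same hinj
  have hcongr : Xᴴ * (-(blockLyapunov A (P₁, P₂))) * X = -(A * X + X * Aᵀ) := by
    rw [hXh, blockLyapunov_apply, ← hD, Matrix.mul_neg, Matrix.neg_mul, Matrix.mul_add,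
      Matrix.add_mul, ← Matrix.mul_assoc X D, hXD, Matrix.one_mul, Matrix.mul_assoc X,
      Matrix.mul_assoc Aᵀ, hDX, Matrix.mul_one, add_comm]
  rwa [hcongr] at hfin
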